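/- (Converse part of Proposition 3.1) Let U ⊆ ℝ³ be an open simply connected set and let φ = (v1, v2, v3, α1, α2, α3) : U → ℝ⁶ be smooth with v1, v2, v3 > 0 and v2^2 = v1^2 + v3^2, satisfying the minimal system on U. Then: (a) the algebraic relation 9 v1^2 v3^8 (v2^2 + v3^2) α1^2 + 9 v1^8 v2^2 (v1^2 - v3^2) α2^2 - 9 v2^8 v3^2 (v1^2 + v2^2) α3^2 - v1^2 v2^2 v3^2 (2 v1^2 v2^4 - 2 v1^2 v3^4 - 2 v2^2 v3^4 - v1^2 v2^2 v3^2) = 0 holds on U; and (b) defining h_{ij} := (1/v_i) ∂v_j/∂u_i for i ≠ j and V1 := -(1/3)(v2/v3 + v3/v2), V2 := -(1/3)(v1/v3 - v3/v1), V3 := (1/3)(v1/v2 + v2/v1), the triple (v, h, V) satisfies, for all pairwise distinct i,j,k ∈ {1,2,3}: ∂v_i/∂u_j = h_{ji} v_j; ∂h_{ik}/∂u_j = h_{ij} h_{jk}; ∂h_{ij}/∂u_i + ∂h_{ji}/∂u_j + h_{ki} h_{kj} + V_i V_j = 0; ∂V_i/∂u_j = h_{ji} V_j. -/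

import Mathlib

noncomputable section

/-- Partial derivative of `f : ℝ³ → ℝ` in the `i`-th coordinate direction `u_{i+1}`. -/
noncomputable def pd (i : Fin 3) (f : (Fin 3 → ℝ) → ℝ) (p : Fin 3 → ℝ) : ℝ :=
  fderiv ℝ f p (Pi.single i 1)

/-- `hh v i j p = h_{ij}(p) = (1/v_i) ∂v_j/∂u_i` (indices shifted down by one:
`v 0, v 1, v 2` are `v₁, v₂, v₃` and directions `0,1,2` are `u₁,u₂,u₃`). -/
noncomputable def hh (v : Fin 3 → (Fin 3 → ℝ) → ℝ) (i j : Fin 3) (p : Fin 3 → ℝ) : ℝ :=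
  (1 / v i p) * pd i (v j) p

/-- The functions `V₁, V₂, V₃` of Proposition 3.1 (minimal case). -/
noncomputable def Vmin (v : Fin 3 → (Fin 3 → ℝ) → ℝ) : Fin 3 → (Fin 3 → ℝ) → ℝ :=
  ![fun p => -(1/3) * (v 1 p / v 2 p + v 2 p / v 1 p),
    fun p => -(1/3) * (v 0 p / v 2 p - v 2 p / v 0 p),
    fun p => (1/3) * (v 0 p / v 1 p + v 1 p / v 0 p)]

/-- `f` is differentiable at `p` with `i`-th partial derivative `d`. -/
def HasPd (i : Fin 3) (f : (Fin 3 → ℝ) → ℝ) (d : ℝ) (p : Fin 3 → ℝ) : Prop :=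
  DifferentiableAt ℝ f p ∧ pd i f p = d

section HasPd

variable {i : Fin 3} {f g : (Fin 3 → ℝ) → ℝ} {d e : ℝ} {p : Fin 3 → ℝ}

lemma HasFDerivAt.hasPd {L : (Fin 3 → ℝ) →L[ℝ] ℝ} (h : HasFDerivAt f L p)
    (hd : L (Pi.single i 1) = d) : HasPd i f d p :=
  ⟨h.differentiableAt, by rw [pd, h.fderiv, hd]⟩

lemma HasPd.congr_deriv (h : HasPd i f d p) (hd : d = e) : HasPd i f e p := hd ▸ h

lemma HasPd.const (c : ℝ) : HasPd i (fun _ => c) 0 p :=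
  (hasFDerivAt_const c p).hasPd rfl

lemma HasPd.add (hf : HasPd i f d p) (hg : HasPd i g e p) :
    HasPd i (fun q => f q + g q) (d + e) p :=
  (hf.1.hasFDerivAt.add hg.1.hasFDerivAt).hasPd (by rw [← hf.2, ← hg.2]; rfl)

lemma HasPd.sub (hf : HasPd i f d p) (hg : HasPd i g e p) :
    HasPd i (fun q => f q - g q) (d - e) p :=
  (hf.1.hasFDerivAt.sub hg.1.hasFDerivAt).hasPd (by rw [← hf.2, ← hg.2]; rfl)

lemma HasPd.mul (hf : HasPd i f d p) (hg : HasPd i g e p) :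
    HasPd i (fun q => f q * g q) (d * g p + f p * e) p :=
  (hf.1.hasFDerivAt.mul hg.1.hasFDerivAt).hasPd (by
    rw [← hf.2, ← hg.2]; simp [pd]; ring)

lemma HasPd.inv (hf : HasPd i f d p) (h0 : f p ≠ 0) :
    HasPd i (fun q => (f q)⁻¹) (-d / f p ^ 2) p :=
  (((hasDerivAt_inv h0).comp_hasFDerivAt p hf.1.hasFDerivAt)).hasPd (by
    rw [← hf.2]; simp [pd]; ring)

lemma HasPd.div (hf : HasPd i f d p) (hg : HasPd i g e p) (h0 : g p ≠ 0) :
    HasPd i (fun q => f q / g q) ((d * g p - f p * e) / g p ^ 2) p := by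
  simp only [div_eq_mul_inv]
  refine (hf.mul (hg.inv h0)).congr_deriv ?_
  field_simp
  ring

lemma HasPd.pow (hf : HasPd i f d p) (n : ℕ) :
    HasPd i (fun q => f q ^ n) (n * f p ^ (n - 1) * d) p :=
  (((hasDerivAt_pow n (f p)).comp_hasFDerivAt p hf.1.hasFDerivAt)).hasPd (by
    rw [← hf.2]; simp [pd])

lemma HasPd.const_mul (c : ℝ) (hf : HasPd i f d p) :
    HasPd i (fun q => c * f q) (c * d) p :=
  ((HasPd.const c).mul hf).congr_deriv (by ring)

lemma HasPd.congr_of_eqOn {U : Set (Fin 3 → ℝ)} (hU : IsOpen U) (hp : p ∈ U)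
    (hg : HasPd i g d p) (hfg : Set.EqOn f g U) : HasPd i f d p := by
  have h : f =ᶠ[nhds p] g := Filter.eventuallyEq_of_mem (hU.mem_nhds hp) hfg
  exact ⟨hg.1.congr_of_eventuallyEq h, by rw [pd, h.fderiv_eq]; exact hg.2⟩

end HasPd

lemma pd_comm {f : (Fin 3 → ℝ) → ℝ} {p : Fin 3 → ℝ} (hf : ContDiffAt ℝ 2 f p) (i j : Fin 3) :
    pd i (pd j f) p = pd j (pd i f) p := by
  have hd : DifferentiableAt ℝ (fderiv ℝ f) p :=
    (hf.fderiv_right (m := 1) (by norm_num)).differentiableAt (by norm_num)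
  have key (k l : Fin 3) :
      pd k (pd l f) p = fderiv ℝ (fderiv ℝ f) p (Pi.single k 1) (Pi.single l 1) := by
    have h := hd.hasFDerivAt.clm_apply (hasFDerivAt_const (Pi.single l (1 : ℝ)) p)
    exact (h.hasPd (i := k) (by simp)).2
  rw [key, key]
  exact (hf.isSymmSndFDerivAt (by simp)).eq _ _

/-- If the iterated derivatives of `f` in two directions are known, they agree. -/
lemma eq_of_hasPd_of_hasPd {U : Set (Fin 3 → ℝ)} (hU : IsOpen U) {f g h : (Fin 3 → ℝ) → ℝ}
    (hf : ContDiffOn ℝ (⊤ : ℕ∞) f U) {i j : Fin 3} (hg : Set.EqOn (pd j f) g U)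
    (hh : Set.EqOn (pd i f) h U) {p : Fin 3 → ℝ} (hp : p ∈ U) {d e : ℝ}
    (hd : HasPd i g d p) (he : HasPd j h e p) : d = e := by
  rw [← (hd.congr_of_eqOn hU hp hg).2, ← (he.congr_of_eqOn hU hp hh).2]
  refine pd_comm ((hf.contDiffAt (hU.mem_nhds hp)).of_le ?_) i j
  exact WithTop.coe_le_coe.2 (le_top : (2 : ℕ∞) ≤ ⊤)

/-- The minimal system on the light cone `y ^ 2 = x ^ 2 + z ^ 2`, with the powers of `y`
eliminated: `x, y, z` stand for `v₁, v₂, v₃` and `A, B, C` for `α₁, α₂, α₃`. -/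
structure MinimalSystemAt (x y z A B C : (Fin 3 → ℝ) → ℝ) (p : Fin 3 → ℝ) : Prop where
  x_pos : 0 < x p
  y_pos : 0 < y p
  z_pos : 0 < z p
  light : y p ^ 2 = x p ^ 2 + z p ^ 2
  x0 : HasPd 0 x (x p / (x p ^ 2 + z p ^ 2) ^ 2 *
    ((x p ^ 2 + z p ^ 2) ^ 2 + (x p ^ 2 + z p ^ 2) * z p ^ 2 + z p ^ 4) * A p) p
  y0 : HasPd 0 y (y p * A p) p
  z0 : HasPd 0 z (z p ^ 5 / (x p ^ 2 + z p ^ 2) ^ 2 * A p) p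
  x1 : HasPd 1 x (x p ^ 5 / z p ^ 4 * B p) p
  y1 : HasPd 1 y (y p / z p ^ 4 * (x p ^ 4 - x p ^ 2 * z p ^ 2 + z p ^ 4) * B p) p
  z1 : HasPd 1 z (z p * B p) p
  x2 : HasPd 2 x (x p * C p) p
  y2 : HasPd 2 y (y p * (x p ^ 2 + z p ^ 2) ^ 2 / x p ^ 4 * C p) p
  z2 : HasPd 2 z (z p / x p ^ 4 *
    (x p ^ 4 + x p ^ 2 * (x p ^ 2 + z p ^ 2) + (x p ^ 2 + z p ^ 2) ^ 2) * C p) p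
  B0 : HasPd 0 B (2 * (x p ^ 2 / (x p ^ 2 + z p ^ 2)) * A p * B p) p
  C0 : HasPd 0 C (2 * (z p ^ 2 / (x p ^ 2 + z p ^ 2) ^ 2) * (4 * z p ^ 2 + x p ^ 2) *
    A p * C p) p
  A1 : HasPd 1 A (2 * (x p ^ 2 / z p ^ 4) * (3 * x p ^ 2 - z p ^ 2) * A p * B p) p
  C1 : HasPd 1 C (2 * ((x p ^ 2 + z p ^ 2) / z p ^ 2) * B p * C p) p
  A2 : HasPd 2 A (-2 * (z p ^ 2 / x p ^ 2) * A p * C p) p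
  B2 : HasPd 2 B (2 * ((x p ^ 2 + z p ^ 2) / x p ^ 4) * (4 * x p ^ 2 + 3 * z p ^ 2) *
    B p * C p) p
  A0 : HasPd 0 A (
    1 / (x p ^ 2 + z p ^ 2) ^ 2 * (3 * (x p ^ 2 + z p ^ 2) ^ 2 - z p ^ 4) * A p ^ 2
    - x p ^ 6 / z p ^ 8 * (3 * x p ^ 2 - 2 * z p ^ 2) * B p ^ 2
    + (x p ^ 2 + z p ^ 2) ^ 2 / (x p ^ 2 * z p ^ 4) * (5 * x p ^ 2 + 2 * z p ^ 2) * C p ^ 2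
    + 1 / (9 * z p ^ 4) * (5 * x p ^ 4 + 2 * (x p ^ 2 + z p ^ 2) * z p ^ 2)) p
  B1 : HasPd 1 B (
    (-1) * (z p ^ 4 / (x p ^ 4 * (x p ^ 2 + z p ^ 2))) * (3 * x p ^ 2 + 5 * z p ^ 2) * A p ^ 2
    - 1 / z p ^ 4 * (x p ^ 4 - 3 * z p ^ 4) * B p ^ 2
    - (x p ^ 2 + z p ^ 2) ^ 3 / x p ^ 8 * (5 * x p ^ 2 + 3 * z p ^ 2) * C p ^ 2
    - 1 / (9 * x p ^ 4) * (5 * (x p ^ 2 + z p ^ 2) ^ 2 - 2 * x p ^ 2 * z p ^ 2)) p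
  C2 : HasPd 2 C (
    z p ^ 6 / (x p ^ 2 + z p ^ 2) ^ 4 * (2 * x p ^ 2 + 5 * z p ^ 2) * A p ^ 2
    + x p ^ 4 / ((x p ^ 2 + z p ^ 2) ^ 2 * z p ^ 2) * (2 * x p ^ 2 - 3 * z p ^ 2) * B p ^ 2
    + 1 / x p ^ 4 * (3 * x p ^ 4 - (x p ^ 2 + z p ^ 2) ^ 2) * C p ^ 2
    + 1 / (9 * (x p ^ 2 + z p ^ 2) ^ 2) * (5 * z p ^ 4 + 2 * x p ^ 2 * (x p ^ 2 + z p ^ 2))) p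

/-- The defect of the algebraic relation between the components of `φ`, with `v₂ ^ 2` eliminated. -/
def algDefect (x z A B C : ℝ) : ℝ :=
  9 * x ^ 2 * z ^ 8 * (x ^ 2 + 2 * z ^ 2) * A ^ 2
    + 9 * x ^ 8 * (x ^ 2 + z ^ 2) * (x ^ 2 - z ^ 2) * B ^ 2
    - 9 * (x ^ 2 + z ^ 2) ^ 4 * z ^ 2 * (2 * x ^ 2 + z ^ 2) * C ^ 2
    - x ^ 2 * (x ^ 2 + z ^ 2) * z ^ 2 *
      (2 * x ^ 2 * (x ^ 2 + z ^ 2) ^ 2 - 2 * x ^ 2 * z ^ 4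
        - 2 * (x ^ 2 + z ^ 2) * z ^ 4 - x ^ 2 * (x ^ 2 + z ^ 2) * z ^ 2)

section Integrability

variable {U : Set (Fin 3 → ℝ)} {x y z A B C : (Fin 3 → ℝ) → ℝ} {p : Fin 3 → ℝ}

lemma MinimalSystemAt.A_mul_algDefect (hU : IsOpen U) (hB : ContDiffOn ℝ (⊤ : ℕ∞) B U)
    (h : ∀ q ∈ U, MinimalSystemAt x y z A B C q) (hp : p ∈ U) :
    A p * algDefect (x p) (z p) (A p) (B p) (C p) = 0 := by
  have H := h p hp
  have hx := H.x_pos.ne'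
  have hz := H.z_pos.ne'
  have hw : x p ^ 2 + z p ^ 2 ≠ 0 := by have := H.x_pos; positivity
  have X := H.x0.pow 2
  have Z := H.z0.pow 2
  have W := X.add Z
  have X' := H.x1.pow 2
  have Z' := H.z1.pow 2
  have W' := X'.add Z'
  have e := eq_of_hasPd_of_hasPd hU hB (i := 0) (j := 1) (fun q hq => (h q hq).B1.2)
    (fun q hq => (h q hq).B0.2) hp
    ((((((((H.z0.pow 4).div ((H.x0.pow 4).mul W) (by positivity)).const_mul (-1)).mul
      ((X.const_mul 3).add (Z.const_mul 5))).mul (H.A0.pow 2)).sub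
      ((((HasPd.const 1).div (H.z0.pow 4) (by positivity)).mul
        ((H.x0.pow 4).sub ((H.z0.pow 4).const_mul 3))).mul (H.B0.pow 2))).sub
      ((((W.pow 3).div (H.x0.pow 8) (by positivity)).mul
        ((X.const_mul 5).add (Z.const_mul 3))).mul (H.C0.pow 2))).sub
      (((HasPd.const 1).div ((H.x0.pow 4).const_mul 9) (by positivity)).mul
        (((W.pow 2).const_mul 5).sub ((X.const_mul 2).mul Z))))
    ((((X'.div W' hw).const_mul 2).mul H.A1).mul H.B1)
  suffices 10 / (9 * x p ^ 6 * (x p ^ 2 + z p ^ 2) ^ 2 * z p ^ 2) *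
      (A p * algDefect (x p) (z p) (A p) (B p) (C p)) = 0 by
    refine (mul_eq_zero.mp this).resolve_left ?_
    positivity
  rw [← sub_eq_zero] at e
  rw [← e, algDefect]
  field_simp
  ring

lemma MinimalSystemAt.B_mul_algDefect (hU : IsOpen U) (hA : ContDiffOn ℝ (⊤ : ℕ∞) A U)
    (h : ∀ q ∈ U, MinimalSystemAt x y z A B C q) (hp : p ∈ U) :
    B p * algDefect (x p) (z p) (A p) (B p) (C p) = 0 := by
  have H := h p hp
  have hx := H.x_pos.ne'
  have hz := H.z_pos.ne'
  have hw : x p ^ 2 + z p ^ 2 ≠ 0 := by have := H.x_pos; positivity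
  have X := H.x0.pow 2
  have Z := H.z0.pow 2
  have X' := H.x1.pow 2
  have Z' := H.z1.pow 2
  have W' := X'.add Z'
  have e := eq_of_hasPd_of_hasPd hU hA (i := 0) (j := 1) (fun q hq => (h q hq).A1.2)
    (fun q hq => (h q hq).A0.2) hp
    ((((((X.div (H.z0.pow 4) (by positivity)).const_mul 2).mul
      ((X.const_mul 3).sub Z)).mul H.A0).mul H.B0))
    (((((((HasPd.const 1).div (W'.pow 2) (by positivity)).mul
      (((W'.pow 2).const_mul 3).sub (H.z1.pow 4))).mul (H.A1.pow 2)).sub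
      ((((H.x1.pow 6).div (H.z1.pow 8) (by positivity)).mul
        ((X'.const_mul 3).sub (Z'.const_mul 2))).mul (H.B1.pow 2))).add
      ((((W'.pow 2).div (X'.mul (H.z1.pow 4)) (by positivity)).mul
        ((X'.const_mul 5).add (Z'.const_mul 2))).mul (H.C1.pow 2))).add
      (((HasPd.const 1).div ((H.z1.pow 4).const_mul 9) (by positivity)).mul
        (((H.x1.pow 4).const_mul 5).add ((W'.const_mul 2).mul Z'))))
  suffices 10 / (9 * (x p ^ 2 + z p ^ 2) * z p ^ 10) *
      (B p * algDefect (x p) (z p) (A p) (B p) (C p)) = 0 by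
    refine (mul_eq_zero.mp this).resolve_left ?_
    positivity
  rw [← sub_eq_zero] at e
  rw [← e, algDefect]
  field_simp
  ring

lemma MinimalSystemAt.C_mul_algDefect (hU : IsOpen U) (hA : ContDiffOn ℝ (⊤ : ℕ∞) A U)
    (h : ∀ q ∈ U, MinimalSystemAt x y z A B C q) (hp : p ∈ U) :
    C p * algDefect (x p) (z p) (A p) (B p) (C p) = 0 := by
  have H := h p hp
  have hx := H.x_pos.ne'
  have hz := H.z_pos.ne'
  have hw : x p ^ 2 + z p ^ 2 ≠ 0 := by have := H.x_pos; positivity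
  have X := H.x2.pow 2
  have Z := H.z2.pow 2
  have W := X.add Z
  have e := eq_of_hasPd_of_hasPd hU hA (i := 0) (j := 2) (fun q hq => (h q hq).A2.2)
    (fun q hq => (h q hq).A0.2) hp
    (((((H.z0.pow 2).div (H.x0.pow 2) (by positivity)).const_mul (-2)).mul H.A0).mul H.C0)
    (((((((HasPd.const 1).div (W.pow 2) (by positivity)).mul
      (((W.pow 2).const_mul 3).sub (H.z2.pow 4))).mul (H.A2.pow 2)).sub
      ((((H.x2.pow 6).div (H.z2.pow 8) (by positivity)).mul
        ((X.const_mul 3).sub (Z.const_mul 2))).mul (H.B2.pow 2))).add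
      ((((W.pow 2).div (X.mul (H.z2.pow 4)) (by positivity)).mul
        ((X.const_mul 5).add (Z.const_mul 2))).mul (H.C2.pow 2))).add
      (((HasPd.const 1).div ((H.z2.pow 4).const_mul 9) (by positivity)).mul
        (((H.x2.pow 4).const_mul 5).add ((W.const_mul 2).mul Z))))
  suffices (-10) / (9 * x p ^ 4 * (x p ^ 2 + z p ^ 2) * z p ^ 6) *
      (C p * algDefect (x p) (z p) (A p) (B p) (C p)) = 0 by
    refine (mul_eq_zero.mp this).resolve_left (div_ne_zero (by norm_num) ?_)
    positivity
  rw [← sub_eq_zero] at e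
  rw [← e, algDefect]
  field_simp
  ring

/-- Where the defect does not vanish, all the functions `α_i` vanish nearby, contradicting the equation
for `∂α₁/∂u₁`. -/
lemma MinimalSystemAt.algDefect_eq_zero (hU : IsOpen U) (hA : ContDiffOn ℝ (⊤ : ℕ∞) A U)
    (hB : ContDiffOn ℝ (⊤ : ℕ∞) B U) (h : ∀ q ∈ U, MinimalSystemAt x y z A B C q)
    (hp : p ∈ U) : algDefect (x p) (z p) (A p) (B p) (C p) = 0 := by
  by_contra hne
  have H := h p hp
  have hx := H.x_pos
  have hz := H.z_pos
  have hcont : ContinuousAt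
      (fun q => algDefect (x q) (z q) (A q) (B q) (C q)) p := by
    have := H.x0.1.continuousAt
    have := H.z0.1.continuousAt
    have := H.A0.1.continuousAt
    have := H.B0.1.continuousAt
    have := H.C0.1.continuousAt
    unfold algDefect
    fun_prop
  have hA0 : A =ᶠ[nhds p] fun _ => 0 := by
    filter_upwards [hcont.eventually_ne hne, hU.mem_nhds hp] with q hq hqU
    exact (mul_eq_zero.mp (MinimalSystemAt.A_mul_algDefect hU hB h hqU)).resolve_right hq
  have hA1 : pd 0 A p = 0 := by rw [pd, hA0.fderiv_eq]; simp
  have e := H.A0.2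
  rw [hA1, hA0.eq_of_nhds,
    (mul_eq_zero.mp (MinimalSystemAt.B_mul_algDefect hU hA h hp)).resolve_right hne,
    (mul_eq_zero.mp (MinimalSystemAt.C_mul_algDefect hU hA h hp)).resolve_right hne] at e
  have hpos : 0 < 1 / (9 * z p ^ 4) * (5 * x p ^ 4 + 2 * (x p ^ 2 + z p ^ 2) * z p ^ 2) := by
    positivity
  linarith

end Integrability

section Holonomic

variable {U : Set (Fin 3 → ℝ)} {v a : Fin 3 → (Fin 3 → ℝ) → ℝ} {p : Fin 3 → ℝ}

lemma MinimalSystemAt.hh01 (H : MinimalSystemAt (v 0) (v 1) (v 2) (a 0) (a 1) (a 2) p) :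
    hh v 0 1 p = v 1 p / v 0 p * a 0 p := by
  have := H.x_pos
  have := H.y_pos
  have := H.z_pos
  rw [hh, H.y0.2]
  field_simp

lemma MinimalSystemAt.hh02 (H : MinimalSystemAt (v 0) (v 1) (v 2) (a 0) (a 1) (a 2) p) :
    hh v 0 2 p = v 2 p ^ 5 / (v 0 p * (v 0 p ^ 2 + v 2 p ^ 2) ^ 2) * a 0 p := by
  have := H.x_pos
  have := H.y_pos
  have := H.z_pos
  rw [hh, H.z0.2]
  field_simp

lemma MinimalSystemAt.hh10 (H : MinimalSystemAt (v 0) (v 1) (v 2) (a 0) (a 1) (a 2) p) :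
    hh v 1 0 p = v 1 p * (v 0 p ^ 5 / (v 2 p ^ 4 * (v 0 p ^ 2 + v 2 p ^ 2))) * a 1 p := by
  have := H.x_pos
  have := H.y_pos
  have := H.z_pos
  rw [hh, H.x1.2]
  field_simp
  rw [H.light]
  ring

lemma MinimalSystemAt.hh12 (H : MinimalSystemAt (v 0) (v 1) (v 2) (a 0) (a 1) (a 2) p) :
    hh v 1 2 p = v 1 p * (v 2 p / (v 0 p ^ 2 + v 2 p ^ 2)) * a 1 p := by
  have := H.x_pos
  have := H.y_pos
  have := H.z_pos
  rw [hh, H.z1.2]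
  field_simp
  rw [H.light]
  ring

lemma MinimalSystemAt.hh20 (H : MinimalSystemAt (v 0) (v 1) (v 2) (a 0) (a 1) (a 2) p) :
    hh v 2 0 p = v 0 p / v 2 p * a 2 p := by
  have := H.x_pos
  have := H.y_pos
  have := H.z_pos
  rw [hh, H.x2.2]
  field_simp

lemma MinimalSystemAt.hh21 (H : MinimalSystemAt (v 0) (v 1) (v 2) (a 0) (a 1) (a 2) p) :
    hh v 2 1 p = v 1 p * ((v 0 p ^ 2 + v 2 p ^ 2) ^ 2 / (v 0 p ^ 4 * v 2 p)) * a 2 p := by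
  have := H.x_pos
  have := H.y_pos
  have := H.z_pos
  rw [hh, H.y2.2]
  field_simp

lemma MinimalSystemAt.pd_hh (hU : IsOpen U)
    (h : ∀ q ∈ U, MinimalSystemAt (v 0) (v 1) (v 2) (a 0) (a 1) (a 2) q) (hp : p ∈ U)
    {i j k : Fin 3} (hij : i ≠ j) (hjk : j ≠ k) (hik : i ≠ k) :
    pd j (hh v i k) p = hh v i j p * hh v j k p := by
  have H := h p hp
  have hx := H.x_pos.ne'
  have hy := H.y_pos.ne'
  have hz := H.z_pos.ne'
  have l2 := H.light
  have hw : v 0 p ^ 2 + v 2 p ^ 2 ≠ 0 := by have := H.x_pos; positivity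
  have e01 : pd 2 (hh v 0 1) p = hh v 0 2 p * hh v 2 1 p := by
    rw [(((H.y2.div H.x2 hx).mul H.A2).congr_of_eqOn hU hp
      fun q hq => (h q hq).hh01).2,
      H.hh02, H.hh21]
    field_simp
    ring
  have e02 : pd 1 (hh v 0 2) p = hh v 0 1 p * hh v 1 2 p := by
    rw [((((H.z1.pow 5).div (H.x1.mul (((H.x1.pow 2).add (H.z1.pow 2)).pow 2))
      (by positivity)).mul H.A1).congr_of_eqOn
      hU hp
      fun q hq => (h q hq).hh02).2,
      H.hh01, H.hh12]
    field_simp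
    simp only [l2]
    ring
  have e10 : pd 2 (hh v 1 0) p = hh v 1 2 p * hh v 2 0 p := by
    rw [(((H.y2.mul ((H.x2.pow 5).div ((H.z2.pow 4).mul ((H.x2.pow 2).add (H.z2.pow 2)))
      (by positivity))).mul H.B2).congr_of_eqOn
      hU hp
      fun q hq => (h q hq).hh10).2,
      H.hh12, H.hh20]
    field_simp
    ring
  have e12 : pd 0 (hh v 1 2) p = hh v 1 0 p * hh v 0 2 p := by
    rw [(((H.y0.mul (H.z0.div ((H.x0.pow 2).add (H.z0.pow 2))
      (by positivity))).mul H.B0).congr_of_eqOn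
      hU hp
      fun q hq => (h q hq).hh12).2,
      H.hh10, H.hh02]
    field_simp
    ring
  have e20 : pd 1 (hh v 2 0) p = hh v 2 1 p * hh v 1 0 p := by
    rw [(((H.x1.div H.z1 hz).mul H.C1).congr_of_eqOn hU hp
      fun q hq => (h q hq).hh20).2,
      H.hh21, H.hh10]
    field_simp
    simp only [l2]
    ring
  have e21 : pd 0 (hh v 2 1) p = hh v 2 0 p * hh v 0 1 p := by
    rw [(((H.y0.mul ((((H.x0.pow 2).add (H.z0.pow 2)).pow 2).div ((H.x0.pow 4).mul H.z0)
      (by positivity))).mul H.C0).congr_of_eqOn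
      hU hp
      fun q hq => (h q hq).hh21).2,
      H.hh20, H.hh01]
    field_simp
    ring
  fin_cases i <;> fin_cases j <;> fin_cases k <;> first | contradiction | assumption

lemma MinimalSystemAt.pd_hh_add_pd_hh (hU : IsOpen U)
    (h : ∀ q ∈ U, MinimalSystemAt (v 0) (v 1) (v 2) (a 0) (a 1) (a 2) q) (hp : p ∈ U)
    {i j k : Fin 3} (hij : i ≠ j) (hjk : j ≠ k) (hik : i ≠ k) :
    pd i (hh v i j) p + pd j (hh v j i) p + hh v k i p * hh v k j p
      + Vmin v i p * Vmin v j p = 0 := by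
  have H := h p hp
  have hx := H.x_pos.ne'
  have hy := H.y_pos.ne'
  have hz := H.z_pos.ne'
  have l2 := H.light
  have hw : v 0 p ^ 2 + v 2 p ^ 2 ≠ 0 := by have := H.x_pos; positivity
  have e01 : pd 0 (hh v 0 1) p + pd 1 (hh v 1 0) p + hh v 2 0 p * hh v 2 1 p
      + Vmin v 0 p * Vmin v 1 p = 0 := by
    rw [(((H.y0.div H.x0 hx).mul H.A0).congr_of_eqOn hU hp
      fun q hq => (h q hq).hh01).2,
      (((H.y1.mul ((H.x1.pow 5).div ((H.z1.pow 4).mul ((H.x1.pow 2).add (H.z1.pow 2)))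
        (by positivity))).mul H.B1).congr_of_eqOn
        hU hp
      fun q hq => (h q hq).hh10).2,
      H.hh20, H.hh21]
    simp only [Vmin, Matrix.cons_val]
    field_simp
    simp only [l2]
    ring
  have e02 : pd 0 (hh v 0 2) p + pd 2 (hh v 2 0) p + hh v 1 0 p * hh v 1 2 p
      + Vmin v 0 p * Vmin v 2 p = 0 := by
    rw [((((H.z0.pow 5).div (H.x0.mul (((H.x0.pow 2).add (H.z0.pow 2)).pow 2))
      (by positivity)).mul H.A0).congr_of_eqOn
      hU hp
      fun q hq => (h q hq).hh02).2,
      (((H.x2.div H.z2 hz).mul H.C2).congr_of_eqOn hU hp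
      fun q hq => (h q hq).hh20).2,
      H.hh10, H.hh12]
    simp only [Vmin, Matrix.cons_val]
    field_simp
    simp only [l2]
    ring
  have e12 : pd 1 (hh v 1 2) p + pd 2 (hh v 2 1) p + hh v 0 1 p * hh v 0 2 p
      + Vmin v 1 p * Vmin v 2 p = 0 := by
    rw [(((H.y1.mul (H.z1.div ((H.x1.pow 2).add (H.z1.pow 2))
      (by positivity))).mul H.B1).congr_of_eqOn
      hU hp
      fun q hq => (h q hq).hh12).2,
      (((H.y2.mul ((((H.x2.pow 2).add (H.z2.pow 2)).pow 2).div ((H.x2.pow 4).mul H.z2)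
        (by positivity))).mul H.C2).congr_of_eqOn
        hU hp
      fun q hq => (h q hq).hh21).2,
      H.hh01, H.hh02]
    simp only [Vmin, Matrix.cons_val]
    field_simp
    simp only [l2]
    ring
  have e10 : pd 1 (hh v 1 0) p + pd 0 (hh v 0 1) p + hh v 2 1 p * hh v 2 0 p
      + Vmin v 1 p * Vmin v 0 p = 0 := by linear_combination e01
  have e20 : pd 2 (hh v 2 0) p + pd 0 (hh v 0 2) p + hh v 1 2 p * hh v 1 0 p
      + Vmin v 2 p * Vmin v 0 p = 0 := by linear_combination e02
  have e21 : pd 2 (hh v 2 1) p + pd 1 (hh v 1 2) p + hh v 0 2 p * hh v 0 1 p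
      + Vmin v 2 p * Vmin v 1 p = 0 := by linear_combination e12
  fin_cases i <;> fin_cases j <;> fin_cases k <;> first | contradiction | assumption

lemma MinimalSystemAt.pd_Vmin
    (H : MinimalSystemAt (v 0) (v 1) (v 2) (a 0) (a 1) (a 2) p) {i j : Fin 3} (hij : i ≠ j) :
    pd j (Vmin v i) p = hh v j i p * Vmin v j p := by
  have hx := H.x_pos.ne'
  have hy := H.y_pos.ne'
  have hz := H.z_pos.ne'
  have l2 := H.light
  have hw : v 0 p ^ 2 + v 2 p ^ 2 ≠ 0 := by have := H.x_pos; positivity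
  have e10 : pd 1 (Vmin v 0) p = hh v 1 0 p * Vmin v 1 p := by
    refine (((H.y1.div H.z1 hz).add (H.z1.div H.y1 hy)).const_mul (-(1 / 3))).2.trans ?_
    rw [H.hh10]
    simp only [Vmin, Matrix.cons_val]
    field_simp
    simp only [l2]
    ring
  have e20 : pd 2 (Vmin v 0) p = hh v 2 0 p * Vmin v 2 p := by
    refine (((H.y2.div H.z2 hz).add (H.z2.div H.y2 hy)).const_mul (-(1 / 3))).2.trans ?_
    rw [H.hh20]
    simp only [Vmin, Matrix.cons_val]
    field_simp
    simp only [l2]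
    ring
  have e01 : pd 0 (Vmin v 1) p = hh v 0 1 p * Vmin v 0 p := by
    refine (((H.x0.div H.z0 hz).sub (H.z0.div H.x0 hx)).const_mul (-(1 / 3))).2.trans ?_
    rw [H.hh01]
    simp only [Vmin, Matrix.cons_val]
    field_simp
    simp only [l2]
    ring
  have e21 : pd 2 (Vmin v 1) p = hh v 2 1 p * Vmin v 2 p := by
    refine (((H.x2.div H.z2 hz).sub (H.z2.div H.x2 hx)).const_mul (-(1 / 3))).2.trans ?_
    rw [H.hh21]
    simp only [Vmin, Matrix.cons_val]
    field_simp
    simp only [l2]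
    ring
  have e02 : pd 0 (Vmin v 2) p = hh v 0 2 p * Vmin v 0 p := by
    refine (((H.x0.div H.y0 hy).add (H.y0.div H.x0 hx)).const_mul (1 / 3)).2.trans ?_
    rw [H.hh02]
    simp only [Vmin, Matrix.cons_val]
    field_simp
    simp only [l2]
    ring
  have e12 : pd 1 (Vmin v 2) p = hh v 1 2 p * Vmin v 1 p := by
    refine (((H.x1.div H.y1 hy).add (H.y1.div H.x1 hx)).const_mul (1 / 3)).2.trans ?_
    rw [H.hh12]
    simp only [Vmin, Matrix.cons_val]
    field_simp
    simp only [l2]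
    ring
  fin_cases i <;> fin_cases j <;> first | contradiction | assumption

end Holonomic

/-- Converse part of Proposition 3.1: a solution `φ = (v₁,v₂,v₃,α₁,α₂,α₃)` of the
minimal system (3.3) on a simply connected open set `U ⊆ ℝ³`, with `v_i > 0` and
`v₂² = v₁² + v₃²`, satisfies the algebraic relation (3.4), and the triple `(v, h, V)`
satisfies the holonomic system (1.2) with `c = 0`. Here `v 0, v 1, v 2` stand for
`v₁, v₂, v₃`, and `a 0, a 1, a 2` stand for `α₁, α₂, α₃`. -/
theorem statement_12 (U : Set (Fin 3 → ℝ)) (hU : IsOpen U) (hsc : SimplyConnectedSpace U)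
    (v a : Fin 3 → (Fin 3 → ℝ) → ℝ)
    (hsm_v : ∀ i, ContDiffOn ℝ (⊤ : ℕ∞) (v i) U) (hsm_a : ∀ i, ContDiffOn ℝ (⊤ : ℕ∞) (a i) U)
    (hpos : ∀ i, ∀ p ∈ U, 0 < v i p)
    (hlight : ∀ p ∈ U, (v 1 p) ^ 2 = (v 0 p) ^ 2 + (v 2 p) ^ 2)
    (hsys : ∀ p ∈ U,
      (pd 0 (v 0) p
        = (v 0 p / (v 1 p) ^ 4) * ((v 1 p) ^ 4 + (v 1 p) ^ 2 * (v 2 p) ^ 2 + (v 2 p) ^ 4)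
          * a 0 p) ∧
      (pd 0 (v 1) p = v 1 p * a 0 p) ∧
      (pd 0 (v 2) p = ((v 2 p) ^ 5 / (v 1 p) ^ 4) * a 0 p) ∧
      (pd 1 (v 0) p = ((v 0 p) ^ 5 / (v 2 p) ^ 4) * a 1 p) ∧
      (pd 1 (v 1) p
        = (v 1 p / (v 2 p) ^ 4) * ((v 0 p) ^ 4 - (v 0 p) ^ 2 * (v 2 p) ^ 2 + (v 2 p) ^ 4)
          * a 1 p) ∧
      (pd 1 (v 2) p = v 2 p * a 1 p) ∧
      (pd 2 (v 0) p = v 0 p * a 2 p) ∧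
      (pd 2 (v 1) p = ((v 1 p) ^ 5 / (v 0 p) ^ 4) * a 2 p) ∧
      (pd 2 (v 2) p
        = (v 2 p / (v 0 p) ^ 4) * ((v 0 p) ^ 4 + (v 0 p) ^ 2 * (v 1 p) ^ 2 + (v 1 p) ^ 4)
          * a 2 p) ∧
      (pd 0 (a 1) p = 2 * ((v 0 p) ^ 2 / (v 1 p) ^ 2) * a 0 p * a 1 p) ∧
      (pd 0 (a 2) p
        = 2 * ((v 2 p) ^ 2 / (v 1 p) ^ 4) * (4 * (v 2 p) ^ 2 + (v 0 p) ^ 2) * a 0 p * a 2 p) ∧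
      (pd 1 (a 0) p
        = 2 * ((v 0 p) ^ 2 / (v 2 p) ^ 4) * (4 * (v 0 p) ^ 2 - (v 1 p) ^ 2) * a 0 p * a 1 p) ∧
      (pd 1 (a 2) p = 2 * ((v 1 p) ^ 2 / (v 2 p) ^ 2) * a 1 p * a 2 p) ∧
      (pd 2 (a 0) p = -2 * ((v 2 p) ^ 2 / (v 0 p) ^ 2) * a 0 p * a 2 p) ∧
      (pd 2 (a 1) p
        = 2 * ((v 1 p) ^ 2 / (v 0 p) ^ 4) * (4 * (v 1 p) ^ 2 - (v 2 p) ^ 2) * a 1 p * a 2 p) ∧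
      (pd 0 (a 0) p
        = (1 / (v 1 p) ^ 4) * (3 * (v 1 p) ^ 4 - (v 2 p) ^ 4) * (a 0 p) ^ 2
          - ((v 0 p) ^ 6 / (v 2 p) ^ 8) * (3 * (v 0 p) ^ 2 - 2 * (v 2 p) ^ 2) * (a 1 p) ^ 2
          + ((v 1 p) ^ 4 / ((v 0 p) ^ 2 * (v 2 p) ^ 4)) * (3 * (v 0 p) ^ 2 + 2 * (v 1 p) ^ 2)
            * (a 2 p) ^ 2
          + (1 / (9 * (v 2 p) ^ 4)) * (5 * (v 0 p) ^ 4 + 2 * (v 1 p) ^ 2 * (v 2 p) ^ 2)) ∧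
      (pd 1 (a 1) p
        = -((v 2 p) ^ 4 / ((v 0 p) ^ 4 * (v 1 p) ^ 2)) * (3 * (v 1 p) ^ 2 + 2 * (v 2 p) ^ 2)
            * (a 0 p) ^ 2
          - (1 / (v 2 p) ^ 4) * ((v 0 p) ^ 4 - 3 * (v 2 p) ^ 4) * (a 1 p) ^ 2
          - ((v 1 p) ^ 6 / (v 0 p) ^ 8) * (2 * (v 0 p) ^ 2 + 3 * (v 1 p) ^ 2) * (a 2 p) ^ 2
          - (1 / (9 * (v 0 p) ^ 4)) * (5 * (v 1 p) ^ 4 - 2 * (v 0 p) ^ 2 * (v 2 p) ^ 2)) ∧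
      (pd 2 (a 2) p
        = ((v 2 p) ^ 6 / (v 1 p) ^ 8) * (2 * (v 1 p) ^ 2 + 3 * (v 2 p) ^ 2) * (a 0 p) ^ 2
          + ((v 0 p) ^ 4 / ((v 1 p) ^ 4 * (v 2 p) ^ 2)) * (2 * (v 0 p) ^ 2 - 3 * (v 2 p) ^ 2)
            * (a 1 p) ^ 2
          + (1 / (v 0 p) ^ 4) * (3 * (v 0 p) ^ 4 - (v 1 p) ^ 4) * (a 2 p) ^ 2
          + (1 / (9 * (v 1 p) ^ 4)) * (5 * (v 2 p) ^ 4 + 2 * (v 0 p) ^ 2 * (v 1 p) ^ 2))) :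
    (∀ p ∈ U,
      9 * (v 0 p) ^ 2 * (v 2 p) ^ 8 * ((v 1 p) ^ 2 + (v 2 p) ^ 2) * (a 0 p) ^ 2
        + 9 * (v 0 p) ^ 8 * (v 1 p) ^ 2 * ((v 0 p) ^ 2 - (v 2 p) ^ 2) * (a 1 p) ^ 2
        - 9 * (v 1 p) ^ 8 * (v 2 p) ^ 2 * ((v 0 p) ^ 2 + (v 1 p) ^ 2) * (a 2 p) ^ 2
        - (v 0 p) ^ 2 * (v 1 p) ^ 2 * (v 2 p) ^ 2 *
          (2 * (v 0 p) ^ 2 * (v 1 p) ^ 4 - 2 * (v 0 p) ^ 2 * (v 2 p) ^ 4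
            - 2 * (v 1 p) ^ 2 * (v 2 p) ^ 4 - (v 0 p) ^ 2 * (v 1 p) ^ 2 * (v 2 p) ^ 2) = 0) ∧
    (∀ p ∈ U, ∀ i j k : Fin 3, i ≠ j → j ≠ k → i ≠ k →
      (pd j (v i) p = hh v j i p * v j p) ∧
      (pd j (hh v i k) p = hh v i j p * hh v j k p) ∧
      (pd i (hh v i j) p + pd j (hh v j i) p + hh v k i p * hh v k j p
        + Vmin v i p * Vmin v j p = 0) ∧
      (pd j (Vmin v i) p = hh v j i p * Vmin v j p)) := by
  have diff {f : (Fin 3 → ℝ) → ℝ} (hf : ContDiffOn ℝ (⊤ : ℕ∞) f U) {p} (hp : p ∈ U) :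
      DifferentiableAt ℝ f p :=
    (hf.contDiffAt (hU.mem_nhds hp)).differentiableAt (by simp)
  have H : ∀ p ∈ U, MinimalSystemAt (v 0) (v 1) (v 2) (a 0) (a 1) (a 2) p := by
    intro p hp
    have hx := hpos 0 p hp
    have hy := hpos 1 p hp
    have hz := hpos 2 p hp
    have l2 := hlight p hp
    have l4 : v 1 p ^ 4 = (v 0 p ^ 2 + v 2 p ^ 2) ^ 2 := by rw [← l2]; ring
    have l5 : v 1 p ^ 5 = v 1 p * (v 0 p ^ 2 + v 2 p ^ 2) ^ 2 := by rw [← l2]; ring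
    have l6 : v 1 p ^ 6 = (v 0 p ^ 2 + v 2 p ^ 2) ^ 3 := by rw [← l2]; ring
    have l8 : v 1 p ^ 8 = (v 0 p ^ 2 + v 2 p ^ 2) ^ 4 := by rw [← l2]; ring
    obtain ⟨s1, s2, s3, s4, s5, s6, s7, s8, s9, s10, s11, s12, s13, s14, s15, s16, s17, s18⟩ :=
      hsys p hp
    simp only [l2, l4, l5, l6, l8] at s1 s2 s3 s4 s5 s6 s7 s8 s9 s10 s11 s12 s13 s14 s15 s16 s17 s18
    constructor
    case x_pos => exact hx
    case y_pos => exact hy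
    case z_pos => exact hz
    case light => exact l2
    case x0 => exact ⟨diff (hsm_v 0) hp, s1⟩
    case y0 => exact ⟨diff (hsm_v 1) hp, s2⟩
    case z0 => exact ⟨diff (hsm_v 2) hp, s3⟩
    case x1 => exact ⟨diff (hsm_v 0) hp, s4⟩
    case y1 => exact ⟨diff (hsm_v 1) hp, s5⟩
    case z1 => exact ⟨diff (hsm_v 2) hp, s6⟩
    case x2 => exact ⟨diff (hsm_v 0) hp, s7⟩
    case y2 => exact ⟨diff (hsm_v 1) hp, s8⟩
    case z2 => exact ⟨diff (hsm_v 2) hp, s9⟩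
    case B0 => exact ⟨diff (hsm_a 1) hp, s10⟩
    case C0 => exact ⟨diff (hsm_a 2) hp, s11⟩
    case A1 => exact ⟨diff (hsm_a 0) hp, by rw [s12]; ring⟩
    case C1 => exact ⟨diff (hsm_a 2) hp, s13⟩
    case A2 => exact ⟨diff (hsm_a 0) hp, s14⟩
    case B2 => exact ⟨diff (hsm_a 1) hp, by rw [s15]; ring⟩
    case A0 => exact ⟨diff (hsm_a 0) hp, by rw [s16]; ring⟩
    case B1 => exact ⟨diff (hsm_a 1) hp, by rw [s17]; ring⟩
    case C2 => exact ⟨diff (hsm_a 2) hp, by rw [s18]; ring⟩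
  refine ⟨fun p hp => ?_, fun p hp i j k hij hjk hik => ⟨?_, ?_, ?_, ?_⟩⟩
  · have e := MinimalSystemAt.algDefect_eq_zero hU (hsm_a 0) (hsm_a 1) H hp
    have l8 : v 1 p ^ 8 = (v 0 p ^ 2 + v 2 p ^ 2) ^ 4 := by rw [← hlight p hp]; ring
    have l4 : v 1 p ^ 4 = (v 0 p ^ 2 + v 2 p ^ 2) ^ 2 := by rw [← hlight p hp]; ring
    rw [← e, algDefect, l8, l4, hlight p hp]
    ring
  · have := (hpos j p hp).ne'
    rw [hh]
    field_simp
  · exact MinimalSystemAt.pd_hh hU H hp hij hjk hik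
  · exact MinimalSystemAt.pd_hh_add_pd_hh hU H hp hij hjk hik
  · exact (H p hp).pd_Vmin hij
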